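/- Assume σ satisfies condition (4.1): T_{deg(a)⁻¹}(T_{deg(c)⁻¹}(σ^{bd}_{ac})) = T_{deg(b)⁻¹}(T_{deg(d)⁻¹}(σ^{bd}_{ac})) for all a,b,c,d ∈ X, and assume σ satisfies conditions (1)–(5). Then the elements x_{ab} := Σ_{c,d∈X} (Q_{ac} ⊗ Q⁻¹_{db})L_{cd} + I_σ of A_σ satisfy, for all a,b ∈ X, Σ_{c∈X} ((L⁻¹)_{cb} + I_σ)x_{ac} = δ_{ab}1_{A_σ} = Σ_{c∈X} x_{cb}((L⁻¹)_{ac} + I_σ). -/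

import Mathlib

open scoped TensorProduct
open MulOpposite

noncomputable section

set_option linter.unusedSectionVars false

variable (k L X G : Type*) [CommRing k] [Ring L] [Algebra k L] [Fintype X]
  [DecidableEq X] [Group G]

/-- The set `Gen` of generators: the underlying set of `L ⊗[k] Lᵐᵒᵖ` together with two
families of formal symbols `L_{ab}` and `(L⁻¹)_{ab}` indexed by `X × X`. -/
abbrev Gen : Type _ := (L ⊗[k] Lᵐᵒᵖ) ⊕ (X × X) ⊕ (X × X)

/-- The generator of `k⟨Gen⟩` corresponding to `ξ ∈ L ⊗[k] Lᵐᵒᵖ`. -/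
def iT (ξ : L ⊗[k] Lᵐᵒᵖ) : FreeAlgebra k (Gen k L X) := FreeAlgebra.ι k (Sum.inl ξ)

/-- The generator `L_{ab}` of `k⟨Gen⟩`. -/
def iL (a b : X) : FreeAlgebra k (Gen k L X) := FreeAlgebra.ι k (Sum.inr (Sum.inl (a, b)))

/-- The generator `(L⁻¹)_{ab}` of `k⟨Gen⟩`. -/
def iLi (a b : X) : FreeAlgebra k (Gen k L X) := FreeAlgebra.ι k (Sum.inr (Sum.inr (a, b)))

/-- `f ⊗ 1_L ∈ L ⊗[k] Lᵐᵒᵖ`. -/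
def sE (f : L) : L ⊗[k] Lᵐᵒᵖ := f ⊗ₜ[k] (1 : Lᵐᵒᵖ)

/-- `1_L ⊗ f ∈ L ⊗[k] Lᵐᵒᵖ`. -/
def tE (f : L) : L ⊗[k] Lᵐᵒᵖ := (1 : L) ⊗ₜ[k] (op f)

variable (deg : X → G) (T : G → L ≃ₐ[k] L) (σ : X → X → X → X → L)

/-- The set of generators (i)–(v) of the two-sided ideal `I_σ`. -/
def relSet : Set (FreeAlgebra k (Gen k L X)) :=
  {w | (∃ ξ ξ' : L ⊗[k] Lᵐᵒᵖ, w = iT k L X ξ + iT k L X ξ' - iT k L X (ξ + ξ')) ∨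
    (∃ (c : k) (ξ : L ⊗[k] Lᵐᵒᵖ), w = c • iT k L X ξ - iT k L X (c • ξ)) ∨
    (∃ ξ ξ' : L ⊗[k] Lᵐᵒᵖ, w = iT k L X ξ * iT k L X ξ' - iT k L X (ξ * ξ')) ∨
    (∃ a b : X, w = (∑ c : X, iL k L X a c * iLi k L X c b) - if a = b then 1 else 0) ∨
    (∃ a b : X, w = (∑ c : X, iLi k L X a c * iL k L X c b) - if a = b then 1 else 0) ∨
    (∃ (f : L) (a b : X),
      w = iT k L X (sE k L (T (deg a) f)) * iL k L X a b - iL k L X a b * iT k L X (sE k L f)) ∨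
    (∃ (f : L) (a b : X),
      w = iT k L X (tE k L (T (deg b) f)) * iL k L X a b - iL k L X a b * iT k L X (tE k L f)) ∨
    (∃ (f : L) (a b : X),
      w = iT k L X (sE k L f) * iLi k L X a b - iLi k L X a b * iT k L X (sE k L (T (deg b) f))) ∨
    (∃ (f : L) (a b : X),
      w = iT k L X (tE k L f) * iLi k L X a b - iLi k L X a b * iT k L X (tE k L (T (deg a) f))) ∨
    (∃ a b c d : X,
      w = (∑ x : X, ∑ y : X, iT k L X (sE k L (σ x y a c)) * iL k L X y d * iL k L X x b) -
        ∑ x : X, ∑ y : X, iT k L X (tE k L (σ b d x y)) * iL k L X c y * iL k L X a x) ∨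
    w = 1 - iT k L X (1 : L ⊗[k] Lᵐᵒᵖ)}

/-- The two-sided ideal `I_σ` of `k⟨Gen⟩`. -/
def Isig : TwoSidedIdeal (FreeAlgebra k (Gen k L X)) :=
  TwoSidedIdeal.span (relSet k L X G deg T σ)

/-- The quotient algebra `A_σ = k⟨Gen⟩ / I_σ`. -/
def Asig : Type _ := (Isig k L X G deg T σ).ringCon.Quotient

instance : Ring (Asig k L X G deg T σ) :=
  inferInstanceAs (Ring (RingCon.Quotient _))

/-- The quotient map `k⟨Gen⟩ → A_σ`, `w ↦ w + I_σ`. -/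
def mkA : FreeAlgebra k (Gen k L X) →+* Asig k L X G deg T σ := RingCon.mk' _

instance : Algebra k (Asig k L X G deg T σ) :=
  RingHom.toAlgebra' ((mkA k L X G deg T σ).comp (algebraMap k (FreeAlgebra k (Gen k L X))))
    (by
      intro c x
      obtain ⟨y, rfl⟩ := Quotient.mk''_surjective (α := FreeAlgebra k (Gen k L X)) x
      show mkA k L X G deg T σ _ * mkA k L X G deg T σ y =
        mkA k L X G deg T σ y * mkA k L X G deg T σ _
      rw [← map_mul, ← map_mul, Algebra.commutes])


section WitnessFormula

variable {L X A : Type*} [Ring L] [Ring A] [Fintype X] [DecidableEq X]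

/-- A cyclic change of the order of summation in a triple sum. -/
theorem sum_rotate {ι M : Type*} [Fintype ι] [AddCommMonoid M] (f : ι → ι → ι → M) :
    (∑ a, ∑ b, ∑ c, f a b c) = ∑ b, ∑ c, ∑ a, f a b c := by
  rw [Finset.sum_comm]
  exact Finset.sum_congr rfl fun b _ => Finset.sum_comm

/-- Contracting a family against a left inverse of its coefficients recovers the family. -/
theorem sum_mul_sum_eq_of_left_inverse (B : X → X → A) (C : X → X → X → X → A)
    (F : X → X → A) (w z : X)
    (h : ∀ x y : X, (∑ a : X, ∑ b : X, B a b * C a b x y) = if x = w ∧ y = z then 1 else 0) :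
    (∑ a : X, ∑ b : X, B a b * ∑ x : X, ∑ y : X, C a b x y * F x y) = F w z := by
  calc (∑ a : X, ∑ b : X, B a b * ∑ x : X, ∑ y : X, C a b x y * F x y)
      = ∑ a : X, ∑ b : X, ∑ x : X, ∑ y : X, B a b * C a b x y * F x y := by
        simp only [Finset.mul_sum, mul_assoc]
    _ = ∑ x : X, ∑ a : X, ∑ b : X, ∑ y : X, B a b * C a b x y * F x y :=
        (sum_rotate _).trans (sum_rotate _)
    _ = ∑ x : X, ∑ y : X, (∑ a : X, ∑ b : X, B a b * C a b x y) * F x y := by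
        simp only [Finset.sum_mul]
        exact Finset.sum_congr rfl fun x _ => (sum_rotate _).trans (sum_rotate _)
    _ = F w z := by simp [h, ite_and]

variable {s : L →+* A} {t : Lᵐᵒᵖ →+* A} {R M : X → X → A}

/-- The exchange relation between `M = R⁻¹` and `R` derived from the `RLL` relation. -/
theorem sum_exchange_of_rll {φ : X → L ≃+* L} {σ : X → X → X → X → L}
    (hRM : ∀ a b, ∑ c, R a c * M c b = if a = b then 1 else 0)
    (hMR : ∀ a b, ∑ c, M a c * R c b = if a = b then 1 else 0)
    (hsM : ∀ f a b, s f * M a b = M a b * s (φ b f))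
    (htM : ∀ f a b, t (op f) * M a b = M a b * t (op (φ a f)))
    (hRLL : ∀ a b c d, ∑ x, ∑ y, s (σ x y a c) * R y d * R x b =
      ∑ x, ∑ y, t (op (σ b d x y)) * R c y * R a x) (a d e f : X) :
    (∑ c, ∑ y, s ((φ c).symm (σ e y a c)) * (M f c * R y d)) =
      ∑ x, ∑ b, t (op ((φ f).symm (σ b d x f))) * (R a x * M b e) := by
  have hMs : ∀ g a b, M a b * s g = s ((φ b).symm g) * M a b := by simp [hsM]
  have hMt : ∀ g a b, M a b * t (op g) = t (op ((φ a).symm g)) * M a b := by simp [htM]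
  have key (c : X) : (∑ y, s (σ e y a c) * R y d) =
      ∑ x, ∑ y, ∑ b, t (op (σ b d x y)) * R c y * (R a x * M b e) := by
    calc (∑ y, s (σ e y a c) * R y d)
        = ∑ x, ∑ y, s (σ x y a c) * R y d * ∑ b, R x b * M b e := by
          simp only [hRM, mul_ite, mul_one, mul_zero]
          rw [Finset.sum_comm]
          simp
      _ = ∑ b, (∑ x, ∑ y, s (σ x y a c) * R y d * R x b) * M b e := by
          simp only [Finset.mul_sum, Finset.sum_mul, mul_assoc]
          exact (sum_rotate _).symm
      _ = ∑ x, ∑ y, ∑ b, t (op (σ b d x y)) * R c y * (R a x * M b e) := by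
          simp only [hRLL]
          simp only [Finset.sum_mul, mul_assoc]
          exact sum_rotate _
  calc (∑ c, ∑ y, s ((φ c).symm (σ e y a c)) * (M f c * R y d))
      = ∑ c, M f c * ∑ y, s (σ e y a c) * R y d := by
        simp only [Finset.mul_sum, ← mul_assoc, hMs]
    _ = ∑ x, ∑ y, ∑ b, t (op ((φ f).symm (σ b d x y))) * ((∑ c, M f c * R c y) *
          (R a x * M b e)) := by
        simp only [key, Finset.mul_sum, Finset.sum_mul, ← mul_assoc, hMt]
        rw [Finset.sum_comm]
        refine Finset.sum_congr rfl fun x _ => ?_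
        rw [Finset.sum_comm]
        exact Finset.sum_congr rfl fun y _ => Finset.sum_comm
    _ = ∑ x, ∑ b, t (op ((φ f).symm (σ b d x f))) * (R a x * M b e) := by
        refine Finset.sum_congr rfl fun x _ => ?_
        rw [Finset.sum_comm]
        simp [hMR]

/-- The exchange relation with the coefficients `τ` replaced by those of the inverse family. -/
theorem sum_exchange_inverse {τ ι : X → X → X → X → L}
    (hst : ∀ f g, s f * t g = t g * s f)
    (hex : ∀ a d e f, (∑ c, ∑ y, s (τ e y a c) * (M f c * R y d)) =
      ∑ x, ∑ b, t (op (τ b d x f)) * (R a x * M b e))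
    (hιτ : ∀ w x y z, (∑ a, ∑ b, ι w a z b * τ b y a x) = if w = x ∧ y = z then 1 else 0)
    (hτι : ∀ w x y z, (∑ a, ∑ b, τ w a z b * ι b y a x) = if w = x ∧ y = z then 1 else 0)
    (v w y z : X) :
    (∑ d, ∑ f, t (op (ι f y d v)) * (M f w * R z d)) =
      ∑ a, ∑ e, s (ι w a z e) * (R a y * M v e) := by
  have key (d f : X) : M f w * R z d =
      ∑ x, ∑ b, t (op (τ b d x f)) * ∑ a, ∑ e, s (ι w a z e) * (R a x * M b e) := by
    rw [← sum_mul_sum_eq_of_left_inverse (fun a e => s (ι w a z e))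
      (fun a e c y => s (τ e y a c)) (fun c y => M f c * R y d) w z]
    · simp only [hex, Finset.mul_sum]
      calc (∑ a, ∑ e, ∑ x, ∑ b, s (ι w a z e) * (t (op (τ b d x f)) * (R a x * M b e)))
          = ∑ a, ∑ e, ∑ x, ∑ b, t (op (τ b d x f)) * (s (ι w a z e) * (R a x * M b e)) := by
            simp only [← mul_assoc, hst]
        _ = ∑ x, ∑ a, ∑ e, ∑ b, t (op (τ b d x f)) * (s (ι w a z e) * (R a x * M b e)) :=
            (sum_rotate _).trans (sum_rotate _)
        _ = ∑ x, ∑ b, ∑ a, ∑ e, t (op (τ b d x f)) * (s (ι w a z e) * (R a x * M b e)) :=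
            Finset.sum_congr rfl fun x _ => (sum_rotate _).trans (sum_rotate _)
    · intro x y
      simp only [← map_mul, ← map_sum, hιτ, eq_comm (a := x)]
      split_ifs <;> simp
  simp only [key]
  rw [sum_mul_sum_eq_of_left_inverse (fun d f => t (op (ι f y d v)))
      (fun d f x b => t (op (τ b d x f)))
      (fun x b => ∑ a, ∑ e, s (ι w a z e) * (R a x * M b e)) y v]
  intro x b
  simp only [← map_mul, ← op_mul, ← map_sum, ← Finset.op_sum, hτι]
  by_cases h1 : b = v <;> by_cases h2 : x = y <;> simp [h1, h2, eq_comm (a := y)]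

/-- A left and a right inverse of `M` for the transposed product agree. -/
theorem eq_of_transposed_inverses {x y : X → X → A}
    (hx : ∀ a b, ∑ c, x c b * M a c = if a = b then 1 else 0)
    (hy : ∀ a b, ∑ c, M c b * y a c = if a = b then 1 else 0) (a b : X) : x a b = y a b := by
  calc x a b = ∑ c, x c b * ∑ d, M d c * y a d := by simp [hy]
    _ = ∑ d, (∑ c, x c b * M d c) * y a d := by
        simp only [Finset.mul_sum, Finset.sum_mul, mul_assoc]
        exact Finset.sum_comm
    _ = y a b := by simp [hx]

/-- The family `∑ s(Q_{cc'}) t(Q⁻¹_{db}) R_{c'd}` is a left inverse of `M` for the transposed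
product. -/
theorem sum_witness_mul {ι : X → X → X → X → L} {Q Qinv : X → X → L}
    (hst : ∀ f g, s f * t g = t g * s f)
    (hMR : ∀ a b, ∑ c, M a c * R c b = if a = b then 1 else 0)
    (hex : ∀ v w y z, (∑ d, ∑ f, t (op (ι f y d v)) * (M f w * R z d)) =
      ∑ a, ∑ e, s (ι w a z e) * (R a y * M v e))
    (hQ : ∀ a b, Q a b = ∑ u, ι u b u a)
    (hQinv : ∀ a c, (∑ b, Q a b * Qinv b c) = if a = c then 1 else 0) (a b : X) :
    (∑ c, (∑ c', ∑ d, s (Q c c') * t (op (Qinv d b)) * R c' d) * M a c) =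
      if a = b then 1 else 0 := by
  have key (v y : X) : (∑ a, ∑ e, s (Q e a) * (R a y * M v e)) = t (op (Q v y)) := by
    calc (∑ a, ∑ e, s (Q e a) * (R a y * M v e))
        = ∑ w, ∑ a, ∑ e, s (ι w a w e) * (R a y * M v e) := by
          simp only [hQ, map_sum, Finset.sum_mul]
          exact (sum_rotate _).symm
      _ = ∑ w, ∑ d, ∑ f, t (op (ι f y d v)) * (M f w * R w d) := by simp only [hex]
      _ = ∑ d, ∑ f, t (op (ι f y d v)) * ∑ w, M f w * R w d := by
          simp only [Finset.mul_sum]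
          exact sum_rotate _
      _ = t (op (Q v y)) := by simp [hMR, hQ, Finset.op_sum]
  calc (∑ c, (∑ c', ∑ d, s (Q c c') * t (op (Qinv d b)) * R c' d) * M a c)
      = ∑ d, t (op (Qinv d b)) * ∑ c', ∑ c, s (Q c c') * (R c' d * M a c) := by
        simp only [hst, Finset.sum_mul, Finset.mul_sum, mul_assoc]
        rw [Finset.sum_comm]
        exact (sum_rotate _).symm
    _ = t (op (∑ d, Q a d * Qinv d b)) := by
        simp only [key, Finset.op_sum, map_sum, op_mul, map_mul]
    _ = if a = b then 1 else 0 := by rw [hQinv]; split_ifs <;> simp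

/-- The family `∑ s(P⁻¹_{az}) t(P_{dc}) R_{zd}` is a right inverse of `M` for the transposed
product. -/
theorem sum_mul_witness {φ : X → L ≃+* L} {ι : X → X → X → X → L} {P Pinv : X → X → L}
    (hRM : ∀ a b, ∑ c, R a c * M c b = if a = b then 1 else 0)
    (hsM : ∀ f a b, s f * M a b = M a b * s (φ b f))
    (htM : ∀ f a b, t (op f) * M a b = M a b * t (op (φ a f)))
    (hex : ∀ v w y z, (∑ d, ∑ f, t (op (ι f y d v)) * (M f w * R z d)) =
      ∑ a, ∑ e, s (ι w a z e) * (R a y * M v e))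
    (hP : ∀ a b, P a b = ∑ u, φ b (ι b u a u))
    (hPinv : ∀ a c, (∑ b, Pinv a b * P b c) = if a = c then 1 else 0) (a b : X) :
    (∑ c, M c b * ∑ z, ∑ d, s (Pinv a z) * t (op (P d c)) * R z d) =
      if a = b then 1 else 0 := by
  have hMs : ∀ g a b, M a b * s g = s ((φ b).symm g) * M a b := by simp [hsM]
  have hMt : ∀ g a b, M a b * t (op g) = t (op ((φ a).symm g)) * M a b := by simp [htM]
  have hP' (a b : X) : (φ b).symm (P a b) = ∑ u, ι b u a u := by simp [hP]
  have key (w z : X) : (∑ c, ∑ d, t (op ((φ c).symm (P d c))) * (M c w * R z d)) =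
      s ((φ w).symm (P z w)) := by
    calc (∑ c, ∑ d, t (op ((φ c).symm (P d c))) * (M c w * R z d))
        = ∑ y, ∑ d, ∑ f, t (op (ι f y d y)) * (M f w * R z d) := by
          simp only [hP', Finset.op_sum, map_sum, Finset.sum_mul]
          rw [Finset.sum_comm]
          exact (sum_rotate _).symm
      _ = ∑ y, ∑ a, ∑ e, s (ι w a z e) * (R a y * M y e) := by simp only [hex]
      _ = ∑ a, ∑ e, s (ι w a z e) * ∑ y, R a y * M y e := by
          simp only [Finset.mul_sum]
          exact sum_rotate _
      _ = s ((φ w).symm (P z w)) := by simp [hRM, hP']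
  calc (∑ c, M c b * ∑ z, ∑ d, s (Pinv a z) * t (op (P d c)) * R z d)
      = ∑ c, ∑ z, ∑ d, s ((φ b).symm (Pinv a z)) *
          (t (op ((φ c).symm (P d c))) * (M c b * R z d)) := by
        simp only [Finset.mul_sum]
        refine Finset.sum_congr rfl fun c _ => Finset.sum_congr rfl fun z _ =>
          Finset.sum_congr rfl fun d _ => ?_
        rw [← mul_assoc, ← mul_assoc, hMs, mul_assoc (s _), hMt, mul_assoc, mul_assoc]
    _ = ∑ z, s ((φ b).symm (Pinv a z)) *
          ∑ c, ∑ d, t (op ((φ c).symm (P d c))) * (M c b * R z d) := by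
        simp only [Finset.mul_sum]
        exact Finset.sum_comm
    _ = s ((φ b).symm (∑ z, Pinv a z * P z b)) := by simp only [key, map_sum, map_mul]
    _ = if a = b then 1 else 0 := by rw [hPinv]; split_ifs <;> simp

end WitnessFormula

section Relations

variable {k L X G}
variable {deg T σ}

theorem mkA_eq_zero_of_mem {w : FreeAlgebra k (Gen k L X)} (hw : w ∈ relSet k L X G deg T σ) :
    mkA k L X G deg T σ w = 0 :=
  (RingCon.eq _).2 (TwoSidedIdeal.subset_span hw)

theorem mkA_eq_of_sub_mem {w w' : FreeAlgebra k (Gen k L X)}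
    (hw : w - w' ∈ relSet k L X G deg T σ) :
    mkA k L X G deg T σ w = mkA k L X G deg T σ w' := by
  rw [← sub_eq_zero, ← map_sub, mkA_eq_zero_of_mem hw]

variable (deg T σ)

/-- The ring homomorphism `L ⊗[k] Lᵐᵒᵖ → A_σ`, `ξ ↦ ξ + I_σ`. -/
def tensorToAsig : L ⊗[k] Lᵐᵒᵖ →+* Asig k L X G deg T σ :=
  RingHom.mk'
    { toFun := fun ξ => mkA k L X G deg T σ (iT k L X ξ)
      map_one' := by
        rw [← map_one (mkA k L X G deg T σ)]
        exact (mkA_eq_of_sub_mem (by simp [relSet])).symm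
      map_mul' := fun ξ ξ' => by
        rw [← map_mul]
        exact (mkA_eq_of_sub_mem (Or.inr (Or.inr (Or.inl ⟨ξ, ξ', rfl⟩)))).symm }
    (fun ξ ξ' => by
      rw [MonoidHom.coe_mk, OneHom.coe_mk, ← map_add]
      exact (mkA_eq_of_sub_mem (Or.inl ⟨ξ, ξ', rfl⟩)).symm)

end Relations

/-- Under conditions (1)–(5), the elements `x_{ab} = Σ_{c,d} (Q_{ac} ⊗ Q⁻¹_{db}) L_{cd} + I_σ`
satisfy `Σ_c (L⁻¹)_{cb} x_{ac} = δ_{ab} 1 = Σ_c x_{cb} (L⁻¹)_{ac}`. -/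
theorem x_witness_formula (hT : ∀ (α : G) (f : L), T α (T α⁻¹ f) = f)
    (h41 : ∀ a b c d : X,
      T (deg a)⁻¹ (T (deg c)⁻¹ (σ b d a c)) = T (deg b)⁻¹ (T (deg d)⁻¹ (σ b d a c)))
    (isg : X → X → X → X → L)
    (h1a : ∀ w x' y z : X,
      (∑ a : X, ∑ b : X, isg w a z b * T (deg x')⁻¹ (σ b y a x')) =
        if w = x' ∧ y = z then 1 else 0)
    (h1b : ∀ w x' y z : X,
      (∑ a : X, ∑ b : X, T (deg b)⁻¹ (σ w a z b) * isg b y a x') =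
        if w = x' ∧ y = z then 1 else 0)
    (Q Qinv : X → X → L)
    (hQ : ∀ a b : X, Q a b = ∑ u : X, isg u b u a)
    (hQinv : ∀ a c : X, (∑ b : X, Q a b * Qinv b c) = if a = c then 1 else 0)
    (Q' Q'inv : X → X → L)
    (hQ' : ∀ a b : X, Q' a b = ∑ u : X, isg b u a u)
    (hQ'inv : ∀ a c : X, (∑ b : X, Q'inv b c * Q' a b) = if a = c then 1 else 0)
    (Q'' Q''inv : X → X → L)
    (hQ'' : ∀ a b : X, Q'' a b = ∑ u : X, T (deg b) (isg b u a u))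
    (hQ''inv : ∀ a c : X, (∑ b : X, Q''inv a b * Q'' b c) = if a = c then 1 else 0)
    (Q''' Q'''inv : X → X → L)
    (hQ''' : ∀ a b : X, Q''' a b = ∑ u : X, T (deg a)⁻¹ (isg u a u b))
    (hQ'''inv : ∀ a c : X, (∑ b : X, Q''' a b * Q'''inv b c) = if a = c then 1 else 0) :
    ∀ a b : X,
      (∑ c : X, mkA k L X G deg T σ (iLi k L X c b) *
        mkA k L X G deg T σ (∑ c' : X, ∑ d : X,
          iT k L X (Q a c' ⊗ₜ[k] op (Qinv d c)) * iL k L X c' d)) =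
        (if a = b then 1 else 0) ∧
      (∑ c : X, mkA k L X G deg T σ (∑ c' : X, ∑ d : X,
          iT k L X (Q c c' ⊗ₜ[k] op (Qinv d b)) * iL k L X c' d) *
        mkA k L X G deg T σ (iLi k L X a c)) = (if a = b then 1 else 0) := by
  let s : L →+* Asig k L X G deg T σ := (tensorToAsig deg T σ).comp
    (Algebra.TensorProduct.includeLeft (R := k) (S := k) (A := L) (B := Lᵐᵒᵖ)).toRingHom
  let t : Lᵐᵒᵖ →+* Asig k L X G deg T σ := (tensorToAsig deg T σ).comp
    (Algebra.TensorProduct.includeRight (R := k) (A := L) (B := Lᵐᵒᵖ)).toRingHom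
  let R : X → X → Asig k L X G deg T σ := fun a b => mkA k L X G deg T σ (iL k L X a b)
  let M : X → X → Asig k L X G deg T σ := fun a b => mkA k L X G deg T σ (iLi k L X a b)
  let φ : X → L ≃+* L := fun a => (T (deg a)).toRingEquiv
  have hφ (a : X) (f : L) : (φ a).symm f = T (deg a)⁻¹ f :=
    (φ a).symm_apply_eq.2 (hT (deg a) f).symm
  have hs (f : L) : s f = mkA k L X G deg T σ (iT k L X (sE k L f)) := rfl
  have ht (f : L) : t (op f) = mkA k L X G deg T σ (iT k L X (tE k L f)) := rfl
  have hst (f : L) (g : Lᵐᵒᵖ) : s f * t g = t g * s f := by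
    change tensorToAsig deg T σ (f ⊗ₜ 1) * tensorToAsig deg T σ (1 ⊗ₜ g) =
      tensorToAsig deg T σ (1 ⊗ₜ g) * tensorToAsig deg T σ (f ⊗ₜ 1)
    simp [← map_mul]
  have hsplit (f g : L) : mkA k L X G deg T σ (iT k L X (f ⊗ₜ[k] op g)) = s f * t (op g) := by
    change tensorToAsig deg T σ (f ⊗ₜ op g) =
      tensorToAsig deg T σ (f ⊗ₜ 1) * tensorToAsig deg T σ (1 ⊗ₜ op g)
    simp [← map_mul]
  have hRM (a b : X) : ∑ c, R a c * M c b = if a = b then 1 else 0 := by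
    have := mkA_eq_of_sub_mem (deg := deg) (T := T) (σ := σ)
      (Or.inr (Or.inr (Or.inr (Or.inl ⟨a, b, rfl⟩))))
    simpa [apply_ite] using this
  have hMR (a b : X) : ∑ c, M a c * R c b = if a = b then 1 else 0 := by
    have := mkA_eq_of_sub_mem (deg := deg) (T := T) (σ := σ)
      (Or.inr (Or.inr (Or.inr (Or.inr (Or.inl ⟨a, b, rfl⟩)))))
    simpa [apply_ite] using this
  have hsM (f : L) (a b : X) : s f * M a b = M a b * s (φ b f) := by
    have := mkA_eq_of_sub_mem (deg := deg) (T := T) (σ := σ)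
      (Or.inr (Or.inr (Or.inr (Or.inr (Or.inr (Or.inr (Or.inr (Or.inl ⟨f, a, b, rfl⟩))))))))
    rwa [map_mul, map_mul] at this
  have htM (f : L) (a b : X) : t (op f) * M a b = M a b * t (op (φ a f)) := by
    have := mkA_eq_of_sub_mem (deg := deg) (T := T) (σ := σ)
      (Or.inr (Or.inr (Or.inr (Or.inr (Or.inr (Or.inr (Or.inr (Or.inr (Or.inl
        ⟨f, a, b, rfl⟩)))))))))
    rwa [map_mul, map_mul] at this
  have hRLL (a b c d : X) : ∑ x, ∑ y, s (σ x y a c) * R y d * R x b =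
      ∑ x, ∑ y, t (op (σ b d x y)) * R c y * R a x := by
    have := mkA_eq_of_sub_mem (deg := deg) (T := T) (σ := σ)
      (Or.inr (Or.inr (Or.inr (Or.inr (Or.inr (Or.inr (Or.inr (Or.inr (Or.inr (Or.inl
        ⟨a, b, c, d, rfl⟩))))))))))
    simp only [map_sum, map_mul] at this
    exact this
  have hex := sum_exchange_inverse (τ := fun e y a c => (φ c).symm (σ e y a c)) hst
    (sum_exchange_of_rll hRM hMR hsM htM hRLL) (by simpa only [hφ] using h1a)
    (by simpa only [hφ] using h1b)
  have hleft := sum_witness_mul hst hMR hex hQ hQinv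
  have hright := sum_mul_witness (P := Q'') (Pinv := Q''inv) hRM hsM htM hex
    (fun a b => by rw [hQ'']; rfl) hQ''inv
  have hxy := eq_of_transposed_inverses
    (x := fun a b => ∑ c, ∑ d, s (Q a c) * t (op (Qinv d b)) * R c d) hleft hright
  intro a b
  simp only [map_sum, map_mul, hsplit]
  refine ⟨?_, hleft a b⟩
  rw [← hright a b]
  exact Finset.sum_congr rfl fun c _ => congrArg (M c b * ·) (hxy a c)

end
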